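/- For all integers k ≥ 3 and n ≥ 1, the generalized 3-connectivity of the k-ary n-cube satisfies κ₃(Q_n^k) = 2n − 1. -/

import Mathlib

/-- There exist `r` internally disjoint trees connecting `S` in `G`: `r` pairwise
edge-disjoint trees `T₁, …, T_r` of `G`, each containing `S`, with
`V(T_a) ∩ V(T_b) = S` for all `a ≠ b`. -/
def ConnectsSet {V : Type*} (G : SimpleGraph V) (S : Set V) (r : ℕ) : Prop :=
  ∃ T : Fin r → G.Subgraph,
    (∀ a, (T a).coe.IsTree) ∧
    (∀ a, S ⊆ (T a).verts) ∧
    (∀ a b, a ≠ b → (T a).verts ∩ (T b).verts = S) ∧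
    (∀ a b, a ≠ b → Disjoint (T a).edgeSet (T b).edgeSet)

/-- `κ_G(S)`: the maximum number of internally disjoint trees connecting `S` in `G`. -/
noncomputable def treeConn {V : Type*} (G : SimpleGraph V) (S : Set V) : ℕ :=
  sSup {r | ConnectsSet G S r}

/-- The generalized 3-connectivity `κ₃(G) = min {κ_G(S) : S ⊆ V(G), |S| = 3}`. -/
noncomputable def kappa3 {V : Type*} (G : SimpleGraph V) : ℕ :=
  sInf {k | ∃ S : Set V, S.ncard = 3 ∧ treeConn G S = k}

/-- The `k`-ary `n`-cube `Q_n^k`: vertices are `(ℤ/kℤ)ⁿ`, and two vertices are adjacent iff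
they differ in exactly one coordinate, and in that coordinate they differ by `±1 (mod k)`. -/
def karyCube (k n : ℕ) : SimpleGraph (Fin n → ZMod k) :=
  SimpleGraph.fromRel (fun u v => ∃ j : Fin n, u j = v j + 1 ∧ ∀ i, i ≠ j → u i = v i)

namespace SimpleGraph

variable {V : Type*} {G : SimpleGraph V}

/-- `u` and `v` are joined by a walk of `G` that avoids `X`. -/
def ReachOff (G : SimpleGraph V) (X : Finset V) (u v : V) : Prop :=
  ∃ p : G.Walk u v, ∀ w ∈ p.support, w ∉ X

namespace ReachOff

variable {X Y : Finset V} {u v w : V}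

lemma refl (h : u ∉ X) : G.ReachOff X u u := ⟨Walk.nil, by simpa using h⟩

lemma symm (h : G.ReachOff X u v) : G.ReachOff X v u := by
  obtain ⟨p, hp⟩ := h
  exact ⟨p.reverse, by simpa using hp⟩

lemma trans (h : G.ReachOff X u v) (h' : G.ReachOff X v w) : G.ReachOff X u w := by
  obtain ⟨p, hp⟩ := h
  obtain ⟨q, hq⟩ := h'
  refine ⟨p.append q, fun x hx => ?_⟩
  rcases (Walk.mem_support_append_iff _ _).1 hx with h | h
  exacts [hp _ h, hq _ h]

lemma of_adj (h : G.Adj u v) (hu : u ∉ X) (hv : v ∉ X) : G.ReachOff X u v :=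
  ⟨h.toWalk, by simp [hu, hv]⟩

lemma right_notMem (h : G.ReachOff X u v) : v ∉ X := h.choose_spec _ (Walk.end_mem_support _)

lemma left_notMem (h : G.ReachOff X u v) : u ∉ X := h.choose_spec _ (Walk.start_mem_support _)

lemma anti (h : G.ReachOff X u v) (hYX : Y ⊆ X) : G.ReachOff Y u v :=
  ⟨h.choose, fun w hw hwY => h.choose_spec w hw (hYX hwY)⟩

/-- A walk avoiding `X` that does not avoid deletion of the edge `xy` yields walks from its ends to
the ends of this edge. -/
lemma of_deleteEdges {a b x y : V} (h : G.ReachOff X a b) :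
    (G.deleteEdges {s(x, y)}).ReachOff X a b ∨
      ((G.deleteEdges {s(x, y)}).ReachOff X a x ∧ (G.deleteEdges {s(x, y)}).ReachOff X y b) ∨
      ((G.deleteEdges {s(x, y)}).ReachOff X a y ∧ (G.deleteEdges {s(x, y)}).ReachOff X x b) := by
  obtain ⟨p, hp⟩ := h
  induction p with
  | nil => exact Or.inl (refl (hp _ (by simp)))
  | @cons u v w huv p ih =>
    have hu : u ∉ X := hp u (by simp)
    have hv : v ∉ X := hp v (by simp)
    have ih := ih fun z hz => hp z (by simp [hz])
    by_cases he : s(u, v) = s(x, y)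
    · rcases Sym2.eq_iff.1 he with ⟨rfl, rfl⟩ | ⟨rfl, rfl⟩
      · rcases ih with ih | ih | ih
        · exact Or.inr (Or.inl ⟨refl hu, ih⟩)
        · exact Or.inr (Or.inl ⟨refl hu, ih.2⟩)
        · exact Or.inl ih.2
      · rcases ih with ih | ih | ih
        · exact Or.inr (Or.inr ⟨refl hu, ih⟩)
        · exact Or.inl ih.2
        · exact Or.inr (Or.inr ⟨refl hu, ih.2⟩)
    · have hs : (G.deleteEdges {s(x, y)}).ReachOff X u v :=
        of_adj (by simpa [deleteEdges_adj, huv] using he) hu hv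
      rcases ih with ih | ih | ih
      · exact Or.inl (hs.trans ih)
      · exact Or.inr (Or.inl ⟨hs.trans ih.1, ih.2⟩)
      · exact Or.inr (Or.inr ⟨hs.trans ih.1, ih.2⟩)

lemma map {W : Type*} {H : SimpleGraph W} {Z : Finset W} (f : G →g H)
    (hf : ∀ w, w ∉ X → f w ∉ Z) (h : G.ReachOff X u v) : H.ReachOff Z (f u) (f v) := by
  obtain ⟨p, hp⟩ := h
  refine ⟨p.map f, fun w hw => ?_⟩
  rw [Walk.support_map, List.mem_map] at hw
  obtain ⟨z, hz, rfl⟩ := hw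
  exact hf _ (hp _ hz)

end ReachOff

/-- Every walk of `G` from `A` to `B` meets `X`. -/
def Separates (G : SimpleGraph V) (A B X : Finset V) : Prop :=
  ∀ a ∈ A, ∀ b ∈ B, ¬ G.ReachOff X a b

lemma Separates.symm {A B X : Finset V} (h : G.Separates A B X) : G.Separates B A X :=
  fun b hb a ha hr => h a ha b hb hr.symm

/-- There are `r` pairwise disjoint paths of `G` from `A` to `B`. -/
def Linked (G : SimpleGraph V) (A B : Finset V) (r : ℕ) : Prop :=
  ∃ (s t : Fin r → V) (p : ∀ i, G.Walk (s i) (t i)),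
    (∀ i, s i ∈ A) ∧ (∀ i, t i ∈ B) ∧ (∀ i, (p i).IsPath) ∧
    ∀ i j, ∀ v ∈ (p i).support, v ∈ (p j).support → i = j

open Classical in
/-- If `S` separates `A` from `B` after deleting the edge `xy`, and `y` lies on the `B`-side, then
separators of `A` from `S ∪ {x}` in the smaller graph separate `A` from `B`. -/
lemma Separates.of_insert {A B S Z : Finset V} {x y : V}
    (hS : (G.deleteEdges {s(x, y)}).Separates A B S)
    (hy : ∀ a ∈ A, ¬ (G.deleteEdges {s(x, y)}).ReachOff S a y)
    (hZ : (G.deleteEdges {s(x, y)}).Separates A (insert x S) Z) : G.Separates A B Z := by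
  have key : ∀ {v b : V} (p : G.Walk v b), b ∈ B → (∀ w ∈ p.support, w ∉ Z) →
      ∀ a ∈ A, ¬ (G.deleteEdges {s(x, y)}).ReachOff (Z ∪ insert x S) a v := by
    intro v b p
    induction p with
    | nil =>
      intro hb _ a ha hr
      exact hS a ha _ hb (hr.anti (by grind))
    | @cons u v w huv p ih =>
      intro hb hpZ a ha hr
      have hu := hr.right_notMem
      have hv : v ∉ Z := hpZ v (by simp)
      have huy : u ≠ y := by
        rintro rfl
        exact hy a ha (hr.anti (by grind))
      have hadj : (G.deleteEdges {s(x, y)}).Adj u v := by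
        simp only [deleteEdges_adj, huv, true_and, Set.mem_singleton_iff, Sym2.eq_iff]
        grind
      by_cases hvX : v ∈ insert x S
      · exact hZ a ha v hvX ((hr.anti (by grind)).trans (.of_adj hadj (by grind) hv))
      · exact ih hb (fun z hz => hpZ z (by simp [hz])) a ha
          (hr.trans (.of_adj hadj hu (by grind)))
  rintro a ha b hb ⟨p, hp⟩
  have haZ : a ∉ Z := hp a (by simp)
  by_cases haX : a ∈ insert x S
  · exact hZ a ha a haX (.refl haZ)
  · exact key p hb hp a ha (.refl (by grind))

open Classical in
/-- A path ending in `t` and otherwise avoiding `X` yields walks avoiding `X` to its other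
vertices. -/
lemma Walk.IsPath.reachOff_of_mem_support {s t v : V} {p : G.Walk s t} (hp : p.IsPath)
    {X : Finset V} (hX : ∀ w ∈ p.support, w ∈ X → w = t) (hv : v ∈ p.support) (hvt : v ≠ t) :
    G.ReachOff X s v := by
  refine ⟨p.takeUntil v hv, fun w hw hwX => ?_⟩
  have := hX w (p.support_takeUntil_subset_support hv hw) hwX
  subst this
  exact Walk.endpoint_notMem_support_takeUntil hp hv hvt.symm hw

/-- If `r` disjoint paths end in a set of size `r`, every vertex of that set is an end. -/
lemma exists_index_of_disjoint {X : Finset V} {r : ℕ} {s t : Fin r → V}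
    {p : ∀ i, G.Walk (s i) (t i)} (ht : ∀ i, t i ∈ X)
    (hd : ∀ i j, ∀ v ∈ (p i).support, v ∈ (p j).support → i = j) (hX : X.card ≤ r) :
    ∀ v ∈ X, ∃ i, t i = v := by
  classical
  have hinj : Function.Injective t := fun i j hij =>
    hd i j (t i) (by simp) (by rw [hij]; simp)
  have : Finset.univ.image t = X := by
    apply Finset.eq_of_subset_of_card_le
    · intro v hv
      obtain ⟨i, -, rfl⟩ := Finset.mem_image.1 hv
      exact ht i
    · rw [Finset.card_image_of_injective _ hinj]
      simpa using hX
  intro v hv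
  rw [← this] at hv
  obtain ⟨i, -, h⟩ := Finset.mem_image.1 hv
  exact ⟨i, h⟩

open Classical in
/-- Gluing disjoint paths along a separator `S` of the graph without the edge `xy` and along this
edge. -/
lemma Linked.glue {A B S : Finset V} {x y : V} {r : ℕ} (hxy : G.Adj x y)
    (hS : (G.deleteEdges {s(x, y)}).Separates A B S) (hr : S.card + 1 = r)
    (hy : ∀ a ∈ A, ¬ (G.deleteEdges {s(x, y)}).ReachOff S a y)
    (hx : ∀ b ∈ B, ¬ (G.deleteEdges {s(x, y)}).ReachOff S b x)
    (hyS : y ∉ S) (hxS : x ∉ S)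
    (h₁ : (G.deleteEdges {s(x, y)}).Linked A (insert x S) r)
    (h₂ : (G.deleteEdges {s(x, y)}).Linked B (insert y S) r) : G.Linked A B r := by
  obtain ⟨a, s, p, ha, hs, hp, hpd⟩ := h₁
  obtain ⟨b, t, q, hb, ht, hq, hqd⟩ := h₂
  have hle : G.deleteEdges {s(x, y)} ≤ G := deleteEdges_le _
  have hne : x ≠ y := hxy.ne
  have hsx := exists_index_of_disjoint hs hpd (by rw [Finset.card_insert_of_notMem hxS]; omega)
  have hty := exists_index_of_disjoint ht hqd (by rw [Finset.card_insert_of_notMem hyS]; omega)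
  have hpX : ∀ i, ∀ w ∈ (p i).support, w ∈ insert x S → w = s i := by
    intro i w hw hwX
    obtain ⟨j, rfl⟩ := hsx w hwX
    rw [hpd i j _ hw (by simp)]
  have hqY : ∀ i, ∀ w ∈ (q i).support, w ∈ insert y S → w = t i := by
    intro i w hw hwX
    obtain ⟨j, rfl⟩ := hty w hwX
    rw [hqd i j _ hw (by simp)]
  have hpr : ∀ i, ∀ w ∈ (p i).support, w ≠ s i →
      (G.deleteEdges {s(x, y)}).ReachOff S (a i) w := fun i w hw hws =>
    ((hp i).reachOff_of_mem_support (hpX i) hw hws).anti (Finset.subset_insert _ _)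
  have hqr : ∀ i, ∀ w ∈ (q i).support, w ≠ t i →
      (G.deleteEdges {s(x, y)}).ReachOff S (b i) w := fun i w hw hwt =>
    ((hq i).reachOff_of_mem_support (hqY i) hw hwt).anti (Finset.subset_insert _ _)
  have hpx : ∀ i, s i = x → (G.deleteEdges {s(x, y)}).ReachOff S (a i) x := by
    intro i hi
    subst hi
    refine ⟨p i, fun w hw hwS => hxS ?_⟩
    rw [← hpX i w hw (by simp [hwS])]; exact hwS
  have hqy : ∀ i, t i = y → (G.deleteEdges {s(x, y)}).ReachOff S (b i) y := by
    intro i hi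
    subst hi
    refine ⟨q i, fun w hw hwS => hyS ?_⟩
    rw [← hqY i w hw (by simp [hwS])]; exact hwS
  have hpq : ∀ i j, ∀ v ∈ (p i).support, v ∈ (q j).support → v = s i ∧ v = t j ∧ v ∈ S := by
    intro i j v hvp hvq
    have hsi := hs i
    have htj := ht j
    by_cases h1 : v = s i
    · subst h1
      by_cases h2 : s i = t j
      · grind
      · exfalso
        have hq' := hqr j _ hvq h2
        rcases Finset.mem_insert.1 hsi with h | h
        · rw [h] at hq'; exact hx _ (hb j) hq'
        · exact hq'.right_notMem h
    · exfalso
      have hp' := hpr i v hvp h1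
      by_cases h2 : v = t j
      · subst h2
        rcases Finset.mem_insert.1 htj with h | h
        · rw [h] at hp'; exact hy _ (ha i) hp'
        · exact hp'.right_notMem h
      · exact hS _ (ha i) _ (hb j) (hp'.trans (hqr j v hvq h2).symm)
  have hmatch : ∀ i, ∃ j, ∃ c : G.Walk (s i) (t j), (s i = t j ∨ s i = x ∧ t j = y) ∧
      ∀ v ∈ c.support, v = s i ∨ v = t j := by
    intro i
    rcases Finset.mem_insert.1 (hs i) with h | h
    · obtain ⟨j, hj⟩ := hty y (by simp)
      refine ⟨j, (Adj.toWalk (by rw [h, hj]; exact hxy)), Or.inr ⟨h, hj⟩, by simp⟩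
    · obtain ⟨j, hj⟩ := hty (s i) (by simp [h])
      exact ⟨j, Walk.nil.copy rfl hj.symm, Or.inl hj.symm, by simp⟩
  choose j c hj hc using hmatch
  have hsinj : ∀ i i', s i = s i' → i = i' := fun i i' h =>
    hpd i i' (s i) (by simp) (by rw [h]; simp)
  have hjinj : ∀ i i', j i = j i' → i = i' := by
    intro i i' h
    apply hsinj
    have h1 := hj i
    have h2 := hj i'
    have h3 := hs i
    have h4 := hs i'
    rw [h] at h1
    grind
  refine ⟨a, fun i => b (j i), fun i => (((p i).mapLe hle).append
    ((c i).append ((q (j i)).mapLe hle).reverse)).bypass, ha, fun i => hb _,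
    fun i => Walk.bypass_isPath _, ?_⟩
  intro i i' v hv hv'
  have key : ∀ i, v ∈ (((p i).mapLe hle).append
      ((c i).append ((q (j i)).mapLe hle).reverse)).bypass.support →
      v ∈ (p i).support ∨ v ∈ (q (j i)).support := by
    intro i hv
    have := Walk.support_bypass_subset_support _ hv
    simp only [Walk.mem_support_append_iff, Walk.support_reverse, List.mem_reverse,
      Walk.support_mapLe_eq_support] at this
    rcases this with h | h | h
    · exact Or.inl h
    · rcases hc i v h with rfl | rfl <;> simp
    · exact Or.inr h
  have cross : ∀ i i', v ∈ (p i).support → v ∈ (q (j i')).support → i = i' := by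
    intro i i' h1 h2
    obtain ⟨h3, h4, h5⟩ := hpq i _ v h1 h2
    apply hsinj
    have := hj i'
    grind
  rcases key i hv with h | h <;> rcases key i' hv' with h' | h'
  · exact hpd _ _ v h h'
  · exact cross i i' h h'
  · exact (cross i' i h' h).symm
  · exact hjinj _ _ (hqd _ _ v h h')

open Classical in
/-- **Menger's theorem** for disjoint paths between two sets of vertices. -/
theorem linked_of_separates [Finite V] (G : SimpleGraph V) (r : ℕ) :
    ∀ A B : Finset V, (∀ X, G.Separates A B X → r ≤ X.card) → G.Linked A B r := by
  induction G using WellFoundedLT.induction with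
  | _ G ih =>
  intro A B hsep
  by_cases hG : ∃ x y, G.Adj x y
  · obtain ⟨x, y, hxy⟩ := hG
    have hlt : G.deleteEdges {s(x, y)} < G := by
      refine lt_of_le_of_ne (deleteEdges_le _) fun h => ?_
      rw [← h] at hxy
      simp at hxy
    have hlt' : G.deleteEdges {s(y, x)} < G := by rwa [Sym2.eq_swap]
    by_cases hS : ∀ X, (G.deleteEdges {s(x, y)}).Separates A B X → r ≤ X.card
    · obtain ⟨s, t, p, hs, ht, hp, hd⟩ := ih _ hlt A B hS
      exact ⟨s, t, fun i => (p i).mapLe hlt.le, hs, ht, fun i => (hp i).mapLe _,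
        by simpa using hd⟩
    · push Not at hS
      obtain ⟨S, hS, hcard⟩ := hS
      have hns : ¬ G.Separates A B S := fun h => by have := hsep S h; omega
      simp only [Separates, not_forall, not_not] at hns
      obtain ⟨a, ha, b, hb, hab⟩ := hns
      have main : ∀ x y, G.Adj x y → G.deleteEdges {s(x, y)} < G →
          (G.deleteEdges {s(x, y)}).Separates A B S →
          (G.deleteEdges {s(x, y)}).ReachOff S a x → (G.deleteEdges {s(x, y)}).ReachOff S y b →
          G.Linked A B r := by
        intro x y hxy hlt hS hax hyb
        have hy : ∀ a ∈ A, ¬ (G.deleteEdges {s(x, y)}).ReachOff S a y :=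
          fun a' ha' h => hS a' ha' b hb (h.trans hyb)
        have hx : ∀ b ∈ B, ¬ (G.deleteEdges {s(x, y)}).ReachOff S b x :=
          fun b' hb' h => hS a ha b' hb' (hax.trans h.symm)
        have hX : G.Separates A B (insert x S) := by
          intro a' ha' b' hb' h
          rcases h.of_deleteEdges (x := x) (y := y) with h | h | h
          · exact hS a' ha' b' hb' (h.anti (Finset.subset_insert _ _))
          · exact h.1.right_notMem (by simp)
          · exact h.2.left_notMem (by simp)
        have hr : S.card + 1 = r := by
          have := hsep _ hX
          have := Finset.card_insert_le x S
          omega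
        refine Linked.glue hxy hS hr hy hx hyb.left_notMem hax.right_notMem
          (ih _ hlt _ _ fun Z hZ => hsep Z (hS.of_insert hy hZ))
          (ih _ hlt _ _ fun Z hZ => hsep Z (Separates.symm ?_))
        rw [Sym2.eq_swap] at hS hx hZ
        exact hS.symm.of_insert hx hZ
      rcases hab.of_deleteEdges (x := x) (y := y) with h | h | h
      · exact absurd h (hS a ha b hb)
      · exact main x y hxy hlt hS h.1 h.2
      · rw [Sym2.eq_swap] at h hS
        exact main y x hxy.symm hlt' hS h.1 h.2
  · push Not at hG
    have hcard : r ≤ (A ∩ B).card := by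
      refine hsep _ ?_
      rintro a ha b hb ⟨p, hp⟩
      cases p with
      | nil => exact hp a (by simp) (by simp [ha, hb])
      | cons h _ => exact hG _ _ h
    obtain ⟨C, hC, hCr⟩ := Finset.exists_subset_card_eq hcard
    let e := C.equivFinOfCardEq hCr
    refine ⟨fun i => (e.symm i : V), fun i => (e.symm i : V), fun i => Walk.nil,
      fun i => (Finset.mem_inter.1 (hC (e.symm i).2)).1,
      fun i => (Finset.mem_inter.1 (hC (e.symm i).2)).2, fun i => Walk.IsPath.nil, ?_⟩
    intro i j v hv hv'
    simp only [Walk.support_nil, List.mem_singleton] at hv hv'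
    exact e.symm.injective (Subtype.ext (hv.symm.trans hv'))

/-- A `d`-regular, `d`-connected graph of even degree. -/
structure RegularConnected [Fintype V] (G : SimpleGraph V) (d : ℕ) : Prop where
  reachOff : ∀ X : Finset V, X.card < d → ∀ u v, u ∉ X → v ∉ X → G.ReachOff X u v
  connected : G.Connected
  exists_neighbors : ∀ y, ∃ N : Finset V, N.card = d ∧ ∀ v, v ∈ N ↔ G.Adj y v
  lt_card : d < Fintype.card V
  even : Even d

/-- **Fan lemma**: `d` prescribed vertices can be joined to `z` by connected subgraphs meeting
only in `z`. -/
lemma RegularConnected.exists_fan [Fintype V] {d : ℕ} (hG : G.RegularConnected d)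
    (z : V) (W : Finset V) (hz : z ∉ W) (hW : W.card ≤ d) :
    ∃ P : V → G.Subgraph, (∀ w ∈ W, (P w).Connected ∧ z ∈ (P w).verts ∧ w ∈ (P w).verts) ∧
      ∀ w ∈ W, ∀ w' ∈ W, w ≠ w' → ∀ v ∈ (P w).verts, v ∈ (P w').verts → v = z := by
  classical
  rcases W.eq_empty_or_nonempty with rfl | ⟨w₀, hw₀⟩
  · exact ⟨fun _ => ⊤, by simp, by simp⟩
  obtain ⟨N, hN, hNz⟩ := hG.exists_neighbors z
  have hlink : G.Linked N W W.card := by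
    refine linked_of_separates G _ _ _ fun X hX => ?_
    by_contra! hlt
    obtain ⟨w, hw, hwX⟩ := Finset.exists_mem_notMem_of_card_lt_card hlt
    obtain ⟨a, ha, haX⟩ := Finset.exists_mem_notMem_of_card_lt_card (s := X) (t := N) (by omega)
    exact hX a ha w hw (hG.reachOff X (by omega) a w haX hwX)
  obtain ⟨s, t, p, hs, ht, -, hd⟩ := hlink
  have hidx := exists_index_of_disjoint ht hd le_rfl
  have : Nonempty (Fin W.card) := ⟨(hidx w₀ hw₀).choose⟩
  choose! j hj using hidx
  have hadj : ∀ i, G.Adj z (s i) := fun i => (hNz _).1 (hs i)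
  have hmem : ∀ i v, v ∈ (G.subgraphOfAdj (hadj i) ⊔ (p i).toSubgraph).verts →
      v = z ∨ v ∈ (p i).support := by
    intro i v hv
    simp only [Subgraph.verts_sup, subgraphOfAdj_verts, Set.mem_union, Set.mem_insert_iff,
      Set.mem_singleton_iff, Walk.mem_verts_toSubgraph] at hv
    rcases hv with (rfl | rfl) | h
    · exact Or.inl rfl
    · exact Or.inr (by simp)
    · exact Or.inr h
  have hend : ∀ i w, t i = w → w ∈ (p i).support := by
    rintro i _ rfl
    simp
  refine ⟨fun w => G.subgraphOfAdj (hadj (j w)) ⊔ (p (j w)).toSubgraph, ?_, ?_⟩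
  · intro w hw
    refine ⟨Subgraph.connected_sup (Subgraph.subgraphOfAdj_connected _).preconnected
      (Walk.toSubgraph_connected _).preconnected ⟨s (j w), by simp⟩, by simp, ?_⟩
    simp [hend _ _ (hj w hw)]
  · intro w hw w' hw' hne v hv hv'
    rcases hmem _ v hv with hp | hp
    · exact hp
    rcases hmem _ v hv' with hp₂ | hp₂
    · exact hp₂
    exact absurd (by rw [← hj w hw, ← hj w' hw', hd _ _ v hp hp₂]) hne

/-- The fan lemma, allowing `z` itself as one of the prescribed vertices. -/
lemma RegularConnected.exists_fan' [Fintype V] [DecidableEq V] {d : ℕ} (hG : G.RegularConnected d)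
    (z : V) (W : Finset V) (hW : (W.erase z).card ≤ d) :
    ∃ P : V → G.Subgraph, (∀ w ∈ W, (P w).Connected ∧ z ∈ (P w).verts ∧ w ∈ (P w).verts) ∧
      ∀ w ∈ W, ∀ w' ∈ W, w ≠ w' → ∀ v ∈ (P w).verts, v ∈ (P w').verts → v = z := by
  obtain ⟨P, hP, hPd⟩ := hG.exists_fan z (W.erase z) (by simp) hW
  refine ⟨fun w => if w = z then G.singletonSubgraph z else P w, fun w hw => ?_, ?_⟩
  · by_cases h : w = z
    · simp [h, Subgraph.singletonSubgraph_connected]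
    · simpa [h] using hP w (by simp [h, hw])
  · intro w hw w' hw' hne v hv hv'
    by_cases h : w = z
    · simpa [h] using hv
    · by_cases h' : w' = z
      · simpa [h'] using hv'
      · exact hPd w (by simp [h, hw]) w' (by simp [h', hw']) hne v (by simpa [h] using hv)
          (by simpa [h'] using hv')

/-- The cycle on `ZMod k`. -/
def zmodCycle (k : ℕ) : SimpleGraph (ZMod k) :=
  SimpleGraph.fromRel fun a b => a = b + 1

section ZModCycle

variable {k : ℕ}

lemma _root_.ZMod.natCast_ne_zero_of_lt {i : ℕ} (h0 : 0 < i) (hi : i < k) : (i : ZMod k) ≠ 0 := by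
  rw [Ne, ZMod.natCast_eq_zero_iff]
  exact Nat.not_dvd_of_pos_of_lt h0 hi

lemma zmodCycle_adj (hk : 3 ≤ k) {a b : ZMod k} :
    (zmodCycle k).Adj a b ↔ a = b + 1 ∨ b = a + 1 := by
  have h1 : (1 : ZMod k) ≠ 0 := by
    simpa using ZMod.natCast_ne_zero_of_lt (k := k) (i := 1) one_pos (by omega)
  rw [zmodCycle, fromRel_adj, and_iff_right_iff_imp]
  rintro (h | h) rfl
  all_goals exact h1 (by simpa using h.symm)

lemma zmodCycle_adj_add_one (hk : 3 ≤ k) (a : ZMod k) : (zmodCycle k).Adj a (a + 1) :=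
  (zmodCycle_adj hk).2 (Or.inr rfl)

lemma _root_.ZMod.exists_eq_add_natCast [NeZero k] (a b : ZMod k) : ∃ i < k, b = a + (i : ℕ) :=
  ⟨(b - a).val, ZMod.val_lt _, by simp⟩

/-- The arc of the cycle consisting of `a, a + 1, …, a + l`. -/
lemma exists_arc (hk : 3 ≤ k) (a : ZMod k) (l : ℕ) :
    ∃ H : (zmodCycle k).Subgraph, H.Connected ∧
      ∀ v, v ∈ H.verts ↔ ∃ i ≤ l, v = a + (i : ℕ) := by
  induction l with
  | zero =>
    exact ⟨(zmodCycle k).singletonSubgraph a, Subgraph.singletonSubgraph_connected, by simp⟩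
  | succ l ih =>
    obtain ⟨H, hH, hv⟩ := ih
    have hadj : (zmodCycle k).Adj (a + (l : ℕ)) (a + (l + 1 : ℕ)) := by
      have := zmodCycle_adj_add_one hk (a + (l : ℕ))
      rwa [add_assoc, ← Nat.cast_succ] at this
    refine ⟨H ⊔ (zmodCycle k).subgraphOfAdj hadj, Subgraph.connected_sup hH.preconnected
      (Subgraph.subgraphOfAdj_connected _).preconnected
      ⟨a + (l : ℕ), (hv _).2 ⟨l, le_rfl, rfl⟩, by simp⟩, fun v => ?_⟩
    simp only [Subgraph.verts_sup, Set.mem_union, hv, subgraphOfAdj_verts, Set.mem_insert_iff,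
      Set.mem_singleton_iff]
    constructor
    · rintro (⟨i, hi, rfl⟩ | rfl | rfl)
      exacts [⟨i, by omega, rfl⟩, ⟨l, by omega, rfl⟩, ⟨l + 1, le_rfl, rfl⟩]
    · rintro ⟨i, hi, rfl⟩
      rcases Nat.lt_or_ge l i with h | h
      · exact Or.inr (Or.inr (by rw [show i = l + 1 by omega]))
      · exact Or.inl ⟨i, h, rfl⟩

lemma zmodCycle_connected (hk : 3 ≤ k) : (zmodCycle k).Connected := by
  have : NeZero k := ⟨by omega⟩
  obtain ⟨H, hH, hv⟩ := exists_arc hk 0 k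
  rw [Subgraph.connected_iff'] at hH
  refine ⟨fun a b => ?_⟩
  have hmem : ∀ a, a ∈ H.verts := fun a => by
    obtain ⟨i, hi, h⟩ := ZMod.exists_eq_add_natCast 0 a
    exact (hv a).2 ⟨i, hi.le, h⟩
  simpa using (hH.preconnected ⟨a, hmem a⟩ ⟨b, hmem b⟩).map H.hom

/-- Two vertices of a cycle lie on an arc whose complement contains an arc with ends next to
these vertices. -/
lemma exists_complementary_arcs (hk : 3 ≤ k) {a c : ZMod k} (hac : a ≠ c) :
    ∃ I J : (zmodCycle k).Subgraph, I.Connected ∧ J.Connected ∧ a ∈ I.verts ∧ c ∈ I.verts ∧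
      (∀ v ∈ I.verts, v ∉ J.verts) ∧
      ∃ d ∈ J.verts, ∃ e ∈ J.verts, (zmodCycle k).Adj a d ∧ (zmodCycle k).Adj c e := by
  have : NeZero k := ⟨by omega⟩
  have hinj : ∀ {i j : ℕ} (b : ZMod k), i < k → j < k → b + (i : ℕ) = b + (j : ℕ) → i = j := by
    intro i j b hi hj h
    rw [add_right_inj, ZMod.natCast_eq_natCast_iff'] at h
    rwa [Nat.mod_eq_of_lt hi, Nat.mod_eq_of_lt hj] at h
  obtain ⟨j, hj, rfl⟩ := ZMod.exists_eq_add_natCast a c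
  have hj0 : j ≠ 0 := by rintro rfl; simp at hac
  have hk0 : (k : ZMod k) = 0 := ZMod.natCast_self k
  rcases Nat.lt_or_ge (j + 1) k with hjk | hjk
  · obtain ⟨I, hI, hIv⟩ := exists_arc hk a j
    obtain ⟨J, hJ, hJv⟩ := exists_arc hk (a + (j + 1 : ℕ)) (k - 1 - (j + 1))
    refine ⟨I, J, hI, hJ, (hIv _).2 ⟨0, by simp⟩, (hIv _).2 ⟨j, le_rfl, rfl⟩, ?_,
      a + (k - 1 : ℕ), (hJv _).2 ⟨k - 1 - (j + 1), le_rfl, ?_⟩, a + (j + 1 : ℕ),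
      (hJv _).2 ⟨0, by simp⟩, ?_, ?_⟩
    · intro v hv hv'
      obtain ⟨i, hi, rfl⟩ := (hIv _).1 hv
      obtain ⟨i', hi', h⟩ := (hJv _).1 hv'
      rw [add_assoc, ← Nat.cast_add] at h
      have := hinj a (by omega) (by omega) h
      omega
    · rw [add_assoc, ← Nat.cast_add]
      congr 2
      omega
    · rw [zmodCycle_adj hk, add_assoc, ← Nat.cast_succ, Nat.succ_eq_add_one,
        show k - 1 + 1 = k by omega, hk0, add_zero]
      exact Or.inl rfl
    · exact (zmodCycle_adj hk).2 (Or.inr (by push_cast; ring))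
  · obtain rfl : j = k - 1 := by omega
    have hka : a + (k - 1 : ℕ) + 1 = a := by
      rw [add_assoc, ← Nat.cast_succ, Nat.succ_eq_add_one,
        show k - 1 + 1 = k by omega, hk0, add_zero]
    obtain ⟨I, hI, hIv⟩ := exists_arc hk (a + (k - 1 : ℕ)) 1
    obtain ⟨J, hJ, hJv⟩ := exists_arc hk (a + (1 : ℕ)) (k - 3)
    refine ⟨I, J, hI, hJ, (hIv _).2 ⟨1, le_rfl, ?_⟩, (hIv _).2 ⟨0, by simp⟩, ?_,
      a + (1 : ℕ), (hJv _).2 ⟨0, by simp⟩, a + (k - 2 : ℕ), (hJv _).2 ⟨k - 3, le_rfl, ?_⟩, ?_, ?_⟩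
    · rw [Nat.cast_one, hka]
    · intro v hv hv'
      obtain ⟨i, hi, rfl⟩ := (hIv _).1 hv
      obtain ⟨i', hi', h⟩ := (hJv _).1 hv'
      rw [add_assoc a (1 : ℕ), ← Nat.cast_add] at h
      obtain rfl | rfl : i = 0 ∨ i = 1 := by omega
      · rw [Nat.cast_zero, add_zero] at h
        have := hinj a (by omega) (by omega) h
        omega
      · rw [Nat.cast_one, hka] at h
        have := hinj a (i := 0) (j := 1 + i') (by omega) (by omega)
          (by rwa [Nat.cast_zero, add_zero])
        omega
    · rw [add_assoc, ← Nat.cast_add]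
      congr 2
      omega
    · rw [zmodCycle_adj hk]
      simp
    · rw [zmodCycle_adj hk, add_assoc a (k - 2 : ℕ), ← Nat.cast_succ]
      refine Or.inl ?_
      congr 2
      omega

end ZModCycle

section Product

variable [Fintype V] {d k : ℕ}

lemma Connected.reachOff_empty {V : Type*} {G : SimpleGraph V} (hG : G.Connected) (u v : V) :
    G.ReachOff ∅ u v := by
  obtain ⟨p⟩ := hG.preconnected u v
  exact ⟨p, by simp⟩

open Classical in
lemma RegularConnected.boxProd_reachOff (hG : G.RegularConnected d) (hk : 3 ≤ k)
    (X : Finset (V × ZMod k)) (hX : X.card < d + 2) (u v : V × ZMod k) (hu : u ∉ X) (hv : v ∉ X) :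
    (G □ zmodCycle k).ReachOff X u v := by
  have : NeZero k := ⟨by omega⟩
  have hone : (1 : ZMod k) ≠ 0 := by
    simpa using ZMod.natCast_ne_zero_of_lt (k := k) (i := 1) one_pos (by omega)
  have htwo : (1 : ZMod k) + 1 ≠ 0 := by
    rw [one_add_one_eq_two]
    simpa using ZMod.natCast_ne_zero_of_lt (k := k) (i := 2) two_pos (by omega)
  obtain ⟨m, hm⟩ := hG.even
  have hV := hG.lt_card
  set f : ZMod k → ℕ := fun c => (X.filter fun x => x.2 = c).card with hf
  set slice : ZMod k → Finset V := fun c => (X.filter fun x => x.2 = c).image Prod.fst with hslice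
  have hslice_le : ∀ c, (slice c).card ≤ f c := fun c => Finset.card_image_le
  have hmem_slice : ∀ v c, v ∈ slice c ↔ (v, c) ∈ X := by
    intro v c
    simp [hslice]
  have hpos : ∀ v c, (v, c) ∈ X → 0 < f c := fun v c h =>
    Finset.card_pos.2 ⟨(v, c), by simp [h]⟩
  have hsum : ∀ T : Finset (ZMod k), ∑ c ∈ T, f c ≤ X.card := by
    intro T
    rw [Finset.card_eq_sum_card_fiberwise (f := Prod.snd) (t := Finset.univ) (by simp)]
    exact Finset.sum_le_sum_of_subset (Finset.subset_univ _)
  have hsum2 : ∀ c c', c ≠ c' → f c + f c' ≤ X.card := by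
    intro c c' h
    rw [← Finset.sum_pair h]
    exact hsum _
  have hgood : ∀ c, (f c < d ∨ f c = 0) → ∀ u v, (u, c) ∉ X → (v, c) ∉ X →
      (G □ zmodCycle k).ReachOff X (u, c) (v, c) := by
    intro c hc u v hu hv
    have h : G.ReachOff (slice c) u v := by
      rcases hc with hc | hc
      · exact hG.reachOff _ ((hslice_le c).trans_lt hc) u v (by rwa [hmem_slice])
          (by rwa [hmem_slice])
      · have h0 : slice c = ∅ := Finset.card_eq_zero.1 (by have := hslice_le c; omega)
        rw [h0]
        exact hG.connected.reachOff_empty u v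
    exact h.map (G.boxProdLeft (zmodCycle k) c).toHom fun w hw => by
      rw [hmem_slice] at hw
      exact hw
  have hjoin : ∀ c c', f c + f c' < Fintype.card V → (zmodCycle k).Adj c c' →
      ∃ w, (w, c) ∉ X ∧ (w, c') ∉ X ∧ (G □ zmodCycle k).ReachOff X (w, c) (w, c') := by
    intro c c' h hadj
    have hlt : (slice c ∪ slice c').card < (Finset.univ : Finset V).card := by
      have := Finset.card_union_le (slice c) (slice c')
      have := hslice_le c
      have := hslice_le c'
      rw [Finset.card_univ]
      omega
    obtain ⟨w, -, hw⟩ := Finset.exists_mem_notMem_of_card_lt_card hlt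
    rw [Finset.mem_union, not_or, hmem_slice, hmem_slice] at hw
    exact ⟨w, hw.1, hw.2, .of_adj (by simp [boxProd_adj, hadj]) hw.1 hw.2⟩
  obtain ⟨c₀, -, hmax⟩ := Finset.exists_max_image Finset.univ f ⟨0, Finset.mem_univ _⟩
  have hother : ∀ c, c ≠ c₀ → f c < d ∨ f c = 0 := by
    intro c hc
    have := hsum2 c c₀ hc
    have := hmax c (Finset.mem_univ _)
    omega
  have hchain : ∀ j : ℕ, 1 ≤ j → j < k → ∀ u v, (u, c₀ + 1) ∉ X → (v, c₀ + (j : ZMod k)) ∉ X →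
      (G □ zmodCycle k).ReachOff X (u, c₀ + 1) (v, c₀ + (j : ZMod k)) := by
    intro j hj
    induction j, hj using Nat.le_induction with
    | base =>
      intro _ u v hu hv
      rw [Nat.cast_one] at hv ⊢
      exact hgood _ (hother _ (by simpa using hone)) u v hu hv
    | succ j hj ih =>
      intro hjk u v hu hv
      have h1 : c₀ + (j : ZMod k) ≠ c₀ := by
        simpa using ZMod.natCast_ne_zero_of_lt (k := k) (i := j) (by omega) (by omega)
      have h2 : c₀ + ((j + 1 : ℕ) : ZMod k) ≠ c₀ := by
        simpa using ZMod.natCast_ne_zero_of_lt (k := k) (i := j + 1) (by omega) (by omega)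
      have hadj : (zmodCycle k).Adj (c₀ + (j : ZMod k)) (c₀ + ((j + 1 : ℕ) : ZMod k)) := by
        rw [Nat.cast_succ, ← add_assoc]
        exact zmodCycle_adj_add_one hk _
      have h3 : f (c₀ + (j : ZMod k)) + f c₀ + f (c₀ + ((j + 1 : ℕ) : ZMod k)) ≤ X.card := by
        have := hsum {c₀ + (j : ZMod k), c₀, c₀ + ((j + 1 : ℕ) : ZMod k)}
        rw [Finset.sum_insert (by
            rw [Finset.mem_insert, Finset.mem_singleton, not_or]
            exact ⟨h1, hadj.ne⟩),
          Finset.sum_pair h2.symm] at this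
        omega
      have h4 := hmax (c₀ + (j : ZMod k)) (Finset.mem_univ _)
      have h5 := hmax (c₀ + ((j + 1 : ℕ) : ZMod k)) (Finset.mem_univ _)
      obtain ⟨w, hw, hw', hww⟩ := hjoin _ _ (by omega) hadj
      exact ((ih (by omega) u w hu hw).trans hww).trans (hgood _ (hother _ h2) w v hw' hv)
  have hne1 : c₀ + 1 ≠ c₀ := by simpa using hone
  obtain ⟨b, hb⟩ : ∃ b, (b, c₀ + 1) ∉ X := by
    have := hother _ hne1
    have := hslice_le (c₀ + 1)
    obtain ⟨b, -, hb⟩ := Finset.exists_mem_notMem_of_card_lt_card (s := slice (c₀ + 1))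
      (t := Finset.univ) (by rw [Finset.card_univ]; omega)
    exact ⟨b, by rwa [hmem_slice] at hb⟩
  have hout : ∀ v c, c ≠ c₀ → (v, c) ∉ X → (G □ zmodCycle k).ReachOff X (v, c) (b, c₀ + 1) := by
    intro v c hc hv
    obtain ⟨j, hj, rfl⟩ := ZMod.exists_eq_add_natCast c₀ c
    have hj0 : j ≠ 0 := by
      rintro rfl
      simp at hc
    exact (hchain j (by omega) hj b v hb hv).symm
  have hall : ∀ v c, (v, c) ∉ X → (G □ zmodCycle k).ReachOff X (v, c) (b, c₀ + 1) := by
    intro v c hv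
    by_cases hc : c = c₀
    · subst hc
      by_cases h1 : (v, c + 1) ∈ X
      · have hadj' : (zmodCycle k).Adj c (c - 1) := (zmodCycle_adj hk).2 (Or.inl (by ring))
        by_cases h2 : (v, c - 1) ∈ X
        · have h3 := hpos _ _ h1
          have h4 := hpos _ _ h2
          have hne : c - 1 ≠ c + 1 := by
            intro h
            apply htwo
            linear_combination -h
          have h5 : f c + (f (c - 1) + f (c + 1)) ≤ X.card := by
            rw [← Finset.sum_pair hne, ← Finset.sum_insert
              (by simp [hadj'.ne, hne1.symm])]
            exact hsum _
          obtain ⟨w, hw, hw', hww⟩ := hjoin c (c + 1) (by omega) (zmodCycle_adj_add_one hk c)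
          exact ((hgood c (by omega) v w hv hw).trans hww).trans (hout w _ hne1 hw')
        · exact (ReachOff.of_adj (by simp [boxProd_adj, hadj']) hv h2).trans
            (hout _ _ hadj'.ne' h2)
      · exact (ReachOff.of_adj (by simp [boxProd_adj, zmodCycle_adj_add_one hk]) hv h1).trans
          (hout _ _ hne1 h1)
    · exact hout v c hc hv
  exact (hall u.1 u.2 hu).trans (hall v.1 v.2 hv).symm

lemma RegularConnected.boxProd [NeZero k] (hG : G.RegularConnected d) (hk : 3 ≤ k) :
    (G □ zmodCycle k).RegularConnected (d + 2) where
  reachOff := hG.boxProd_reachOff hk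
  connected := hG.connected.boxProd (zmodCycle_connected hk)
  exists_neighbors := by
    classical
    rintro ⟨y, c⟩
    obtain ⟨N, hN, hNy⟩ := hG.exists_neighbors y
    have htwo : (1 : ZMod k) + 1 ≠ 0 := by
      rw [one_add_one_eq_two]
      simpa using ZMod.natCast_ne_zero_of_lt (k := k) (i := 2) two_pos (by omega)
    have hne : c - 1 ≠ c + 1 := by
      intro h
      apply htwo
      linear_combination -h
    refine ⟨N ×ˢ {c} ∪ {y} ×ˢ {c - 1, c + 1}, ?_, ?_⟩
    · rw [Finset.card_union_of_disjoint, Finset.card_product, Finset.card_product,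
        Finset.card_pair hne, hN]
      · simp
      · rw [Finset.disjoint_left]
        rintro ⟨v, b⟩ h h'
        simp only [Finset.mem_product, Finset.mem_singleton] at h h'
        obtain rfl := h'.1
        exact G.irrefl ((hNy _).1 h.1)
    · rintro ⟨v, b⟩
      simp only [Finset.mem_union, Finset.mem_product, Finset.mem_singleton, hNy,
        Finset.mem_insert, boxProd_adj, zmodCycle_adj hk]
      have : b = c - 1 ↔ c = b + 1 := by
        constructor <;> rintro rfl <;> ring
      rw [this]
      tauto
  lt_card := by
    have := hG.lt_card
    rw [Fintype.card_prod, ZMod.card]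
    nlinarith
  even := hG.even.add even_two

lemma RegularConnected.iso {W : Type*} [Fintype W] {H : SimpleGraph W}
    (hG : G.RegularConnected d) (e : G ≃g H) : H.RegularConnected d where
  reachOff X hX u v hu hv := by
    have hmem : ∀ w, e.symm w ∈ X.map e.symm.toEquiv.toEmbedding ↔ w ∈ X :=
      fun w => Finset.mem_map' _
    have := hG.reachOff (X.map e.symm.toEquiv.toEmbedding) (by simpa using hX) (e.symm u) (e.symm v)
      (by rwa [hmem]) (by rwa [hmem])
    have := this.map (Z := X) e.toHom fun w hw hw' => hw (by
      rw [← e.symm_apply_apply w, hmem]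
      exact hw')
    simpa using this
  connected := e.connected_iff.1 hG.connected
  exists_neighbors y := by
    obtain ⟨N, hN, hNy⟩ := hG.exists_neighbors (e.symm y)
    refine ⟨N.map e.toEquiv.toEmbedding, by simpa using hN, fun v => ?_⟩
    rw [Finset.mem_map_equiv, hNy]
    exact e.symm.map_adj_iff
  lt_card := by
    rw [← e.card_eq]
    exact hG.lt_card
  even := hG.even

end Product

variable {W : Type*} {H : SimpleGraph W}

lemma Subgraph.Connected.map_hom {K : G.Subgraph} (hK : K.Connected) (f : G →g H) :
    (K.map f).Connected := by
  rw [Subgraph.connected_iff'] at hK ⊢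
  let g : K.coe →g (K.map f).coe :=
    ⟨fun v => ⟨f v, v, v.2, rfl⟩, fun {u v} h => ⟨u, v, h, rfl, rfl⟩⟩
  refine hK.map g ?_
  rintro ⟨_, v, hv, rfl⟩
  exact ⟨⟨v, hv⟩, rfl⟩

/-- A connected subgraph has a spanning tree. -/
lemma Subgraph.Connected.exists_spanning_tree [Finite V] {K : G.Subgraph} (hK : K.Connected) :
    ∃ T : G.Subgraph, T.verts = K.verts ∧ T ≤ K ∧ T.coe.IsTree := by
  rw [Subgraph.connected_iff'] at hK
  obtain ⟨T, hle, hT⟩ := hK.exists_isTree_le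
  refine ⟨⟨K.verts, fun u v => ∃ hu hv, T.Adj ⟨u, hu⟩ ⟨v, hv⟩, ?_, ?_, ?_⟩, rfl, ⟨le_rfl, ?_⟩, ?_⟩
  · rintro u v ⟨hu, hv, h⟩
    exact K.adj_sub (hle h)
  · rintro u v ⟨hu, hv, h⟩
    exact hu
  · constructor
    rintro u v ⟨hu, hv, h⟩
    exact ⟨hv, hu, h.symm⟩
  · rintro u v ⟨hu, hv, h⟩
    exact hle h
  · convert hT
    ext u v
    exact ⟨fun ⟨_, _, h⟩ => h, fun h => ⟨u.2, v.2, h⟩⟩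

/-- Instead of trees, it suffices to provide connected subgraphs. -/
lemma connectsSet_of_connected [Finite V] {S : Set V} {ι : Type*} [Fintype ι]
    (K : ι → G.Subgraph) (hc : ∀ a, (K a).Connected) (hS : ∀ a, S ⊆ (K a).verts)
    (hv : ∀ a b, a ≠ b → ∀ v ∈ (K a).verts, v ∈ (K b).verts → v ∈ S)
    (he : ∀ a b, a ≠ b → ∀ u v, (K a).Adj u v → ¬ (K b).Adj u v) :
    ConnectsSet G S (Fintype.card ι) := by
  choose T hTv hTle hT using fun a => (hc a).exists_spanning_tree
  let e := (Fintype.equivFin ι).symm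
  refine ⟨fun i => T (e i), fun i => hT _, fun i => by rw [hTv]; exact hS _, fun a b hab => ?_,
    fun a b hab => ?_⟩
  · rw [hTv, hTv]
    exact Set.Subset.antisymm (fun v h => hv _ _ (e.injective.ne hab) v h.1 h.2)
      (Set.subset_inter (hS _) (hS _))
  · rw [Set.disjoint_left]
    intro s
    induction s with
    | _ u v =>
      intro h h'
      exact he _ _ (e.injective.ne hab) u v ((hTle _).2 h) ((hTle _).2 h')

lemma _root_.ConnectsSet.iso [Finite W] {S : Set V} {r : ℕ} (h : ConnectsSet G S r) (e : G ≃g H) :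
    ConnectsSet H (e '' S) r := by
  obtain ⟨T, hT, hS, hv, he⟩ := h
  have := connectsSet_of_connected (S := e '' S) (fun a => (T a).map e.toHom)
    (fun a => Subgraph.Connected.map_hom ((Subgraph.connected_iff' (H := T a)).2 (hT a).connected) _)
    (fun a => Set.image_mono (hS a)) ?_ ?_
  · simpa using this
  · rintro a b hab _ ⟨v, hva, rfl⟩ ⟨w, hwb, hw⟩
    obtain rfl : w = v := e.injective hw
    exact ⟨w, by rw [← hv a b hab]; exact ⟨hva, hwb⟩, rfl⟩
  · rintro a b hab _ _ ⟨u, v, huv, rfl, rfl⟩ ⟨u', v', huv', hu, hv⟩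
    obtain rfl : u' = u := e.injective hu
    obtain rfl : v' = v := e.injective hv
    exact Set.disjoint_left.1 (he a b hab) (show s(u', v') ∈ (T a).edgeSet from huv) huv'

/-- The copy of a subgraph of the first factor at height `a`. -/
def level (H : SimpleGraph W) (a : W) (K : G.Subgraph) : (G □ H).Subgraph :=
  K.map (G.boxProdLeft H a).toHom

/-- The copy of a subgraph of the second factor above `v`. -/
def column (G : SimpleGraph V) (v : V) (K : H.Subgraph) : (G □ H).Subgraph :=
  K.map (G.boxProdRight H v).toHom

@[simp]
lemma mem_level_verts {a : W} {K : G.Subgraph} {p : V × W} :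
    p ∈ (level H a K).verts ↔ p.2 = a ∧ p.1 ∈ K.verts := by
  constructor
  · rintro ⟨v, hv, rfl⟩
    exact ⟨rfl, hv⟩
  · rintro ⟨rfl, h⟩
    exact ⟨p.1, h, rfl⟩

@[simp]
lemma mem_column_verts {v : V} {K : H.Subgraph} {p : V × W} :
    p ∈ (column G v K).verts ↔ p.1 = v ∧ p.2 ∈ K.verts := by
  constructor
  · rintro ⟨v, hv, rfl⟩
    exact ⟨rfl, hv⟩
  · rintro ⟨rfl, h⟩
    exact ⟨p.2, h, rfl⟩

@[simp]
lemma level_adj {a : W} {K : G.Subgraph} {p q : V × W} :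
    (level H a K).Adj p q ↔ p.2 = a ∧ q.2 = a ∧ K.Adj p.1 q.1 := by
  constructor
  · rintro ⟨u, v, h, rfl, rfl⟩
    exact ⟨rfl, rfl, h⟩
  · rintro ⟨h1, h2, h⟩
    exact ⟨p.1, q.1, h, Prod.ext rfl h1.symm, Prod.ext rfl h2.symm⟩

@[simp]
lemma column_adj {v : V} {K : H.Subgraph} {p q : V × W} :
    (column G v K).Adj p q ↔ p.1 = v ∧ q.1 = v ∧ K.Adj p.2 q.2 := by
  constructor
  · rintro ⟨u, v, h, rfl, rfl⟩
    exact ⟨rfl, rfl, h⟩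
  · rintro ⟨h1, h2, h⟩
    exact ⟨p.2, q.2, h, Prod.ext h1.symm rfl, Prod.ext h2.symm rfl⟩

lemma Subgraph.Connected.level {K : G.Subgraph} (hK : K.Connected) (a : W) :
    (level H a K).Connected := hK.map_hom _

lemma Subgraph.Connected.column {K : H.Subgraph} (hK : K.Connected) (v : V) :
    (column G v K).Connected := hK.map_hom _

lemma Subgraph.Connected.sup_of_mem {K L : G.Subgraph} (hK : K.Connected) (hL : L.Connected)
    (v : V) (hv : v ∈ K.verts) (hv' : v ∈ L.verts) : (K ⊔ L).Connected :=
  Subgraph.connected_sup hK.preconnected hL.preconnected ⟨v, hv, hv'⟩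

lemma RegularConnected.eq_of_degree_zero [Fintype V] (hG : G.RegularConnected 0) (u v : V) :
    u = v := by
  obtain ⟨p⟩ := hG.connected.preconnected u v
  cases p with
  | nil => rfl
  | cons h _ =>
    obtain ⟨N, hN, hNu⟩ := hG.exists_neighbors u
    rw [Finset.card_eq_zero] at hN
    simpa [hN] using (hNu _).2 h

lemma subgraph_top_connected (hG : G.Connected) : (⊤ : G.Subgraph).Connected := by
  rw [Subgraph.connected_iff']
  exact (Subgraph.topIso (G := G)).connected_iff.2 hG

section Product

variable [Fintype V] {d k : ℕ}

/-- Three vertices at different heights. -/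
lemma RegularConnected.connectsSet_of_three_levels (hG : G.RegularConnected d) (hk : 3 ≤ k)
    (x y z : V × ZMod k) (hxy : x.2 ≠ y.2) (hxz : x.2 ≠ z.2) (hyz : y.2 ≠ z.2) :
    ConnectsSet (G □ zmodCycle k) {x, y, z} (d + 1) := by
  classical
  have : NeZero k := ⟨by omega⟩
  have hcard : ({x.1, y.1, z.1} : Finset V).card ≤ d + 1 := by
    obtain rfl | hd := Nat.eq_zero_or_pos d
    · rw [hG.eq_of_degree_zero y.1 x.1, hG.eq_of_degree_zero z.1 x.1]
      simp
    · obtain ⟨m, hm⟩ := hG.even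
      have := Finset.card_le_three (a := x.1) (b := y.1) (c := z.1)
      omega
  obtain ⟨A, hsub, hA⟩ := Finset.exists_superset_card_eq hcard hG.lt_card
  have hxA : x.1 ∈ A := hsub (by simp)
  have hyA : y.1 ∈ A := hsub (by simp)
  have hzA : z.1 ∈ A := hsub (by simp)
  have hfan : ∀ v ∈ A, (A.erase v).card ≤ d := fun v hv => by
    rw [Finset.card_erase_of_mem hv]
    omega
  obtain ⟨P, hP, hPd⟩ := hG.exists_fan' x.1 A (hfan _ hxA)
  obtain ⟨Q, hQ, hQd⟩ := hG.exists_fan' y.1 A (hfan _ hyA)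
  obtain ⟨R, hR, hRd⟩ := hG.exists_fan' z.1 A (hfan _ hzA)
  have hC : (⊤ : (zmodCycle k).Subgraph).Connected :=
    subgraph_top_connected (zmodCycle_connected hk)
  have hcardA : Fintype.card A = d + 1 := by simpa using hA
  rw [← hcardA]
  refine connectsSet_of_connected (fun w : A => column G w.1 ⊤ ⊔ level _ x.2 (P w) ⊔
    level _ y.2 (Q w) ⊔ level _ z.2 (R w)) ?_ ?_ ?_ ?_
  · rintro ⟨w, hw⟩
    refine (((hC.column w).sup_of_mem ((hP w hw).1.level _) (w, x.2) ?_ ?_).sup_of_mem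
      ((hQ w hw).1.level _) (w, y.2) ?_ ?_).sup_of_mem ((hR w hw).1.level _) (w, z.2) ?_ ?_
    all_goals simp [hP w hw, hQ w hw, hR w hw]
  · rintro ⟨w, hw⟩ v hv
    rcases hv with rfl | rfl | rfl
    all_goals simp [hP w hw, hQ w hw, hR w hw]
  · rintro ⟨w, hw⟩ ⟨w', hw'⟩ hne ⟨v, c⟩ hv hv'
    replace hne : w ≠ w' := fun h => hne (Subtype.ext h)
    have h1 := hP w hw
    have h2 := hQ w hw
    have h3 := hR w hw
    have h4 := hP w' hw'
    have h5 := hQ w' hw'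
    have h6 := hR w' hw'
    have h7 := hPd w hw w' hw' hne
    have h8 := hQd w hw w' hw' hne
    have h9 := hRd w hw w' hw' hne
    simp only [Subgraph.verts_sup, Set.mem_union, mem_column_verts, mem_level_verts,
      Subgraph.verts_top, Set.mem_univ, and_true] at hv hv'
    simp only [Set.mem_insert_iff, Set.mem_singleton_iff, Prod.ext_iff]
    grind
  · rintro ⟨w, hw⟩ ⟨w', hw'⟩ hne ⟨u, c⟩ ⟨v, c'⟩ h h'
    replace hne : w ≠ w' := fun h => hne (Subtype.ext h)
    simp only [Subgraph.sup_adj, column_adj, level_adj, Subgraph.top_adj] at h h'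
    have irr : ∀ (K L : V → G.Subgraph) (t : V),
        (∀ v ∈ (K w).verts, v ∈ (L w').verts → v = t) → (K w).Adj u v → ¬ (L w').Adj u v := by
      intro K L t ht h h'
      exact h.ne ((ht _ h.fst_mem h'.fst_mem).trans (ht _ h.snd_mem h'.snd_mem).symm)
    have h7 := irr P P _ (hPd w hw w' hw' hne)
    have h8 := irr Q Q _ (hQd w hw w' hw' hne)
    have h9 := irr R R _ (hRd w hw w' hw' hne)
    have h10 : ∀ (K : G.Subgraph), K.Adj u v → u ≠ v := fun K h => h.ne
    have h11 : (zmodCycle k).Adj c c' → c ≠ c' := fun h => h.ne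
    grind

/-- Two vertices at one height, the third one at another height. -/
lemma RegularConnected.connectsSet_of_two_levels (hG : G.RegularConnected d) (hk : 3 ≤ k)
    (x y z : V × ZMod k) (hxy : x ≠ y) (hxy₂ : x.2 = y.2) (hxz : x.2 ≠ z.2) :
    ConnectsSet (G □ zmodCycle k) {x, y, z} (d + 1) := by
  classical
  have : NeZero k := ⟨by omega⟩
  obtain ⟨x, a⟩ := x
  obtain ⟨y, b⟩ := y
  obtain ⟨z, c⟩ := z
  obtain rfl : a = b := hxy₂
  replace hxy : x ≠ y := by simpa using hxy
  replace hxz : a ≠ c := hxz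
  obtain ⟨A, hA, hxA, hAy⟩ : ∃ A : Finset V, A.card = d ∧ x ∉ A ∧ ∀ w ∈ A, w = y ∨ G.Adj y w := by
    obtain ⟨N, hN, hNy⟩ := hG.exists_neighbors y
    by_cases hx : x ∈ N
    · refine ⟨insert y (N.erase x), ?_, by simp [hxy], ?_⟩
      · have := Finset.card_pos.2 ⟨x, hx⟩
        rw [Finset.card_insert_of_notMem (by simp [hNy]), Finset.card_erase_of_mem hx]
        omega
      · intro w hw
        simp only [Finset.mem_insert, Finset.mem_erase, hNy] at hw
        tauto
    · exact ⟨N, hN, hx, fun w hw => Or.inr ((hNy w).1 hw)⟩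
  have hY : ∀ w ∈ A, ∃ Y : G.Subgraph, Y.Connected ∧ (∀ v, v ∈ Y.verts ↔ v = y ∨ v = w) := by
    intro w hw
    rcases hAy w hw with rfl | h
    · exact ⟨G.singletonSubgraph w, Subgraph.singletonSubgraph_connected, by simp⟩
    · exact ⟨G.subgraphOfAdj h, Subgraph.subgraphOfAdj_connected _, by simp⟩
  choose! Y hY hYv using hY
  obtain ⟨P, hP, hPd⟩ := hG.exists_fan x A hxA hA.le
  obtain ⟨R, hR, hRd⟩ := hG.exists_fan' z A ((Finset.card_erase_le).trans hA.le)
  obtain ⟨I, J, hI, hJ, haI, hcI, hIJ, i, hi, j, hj, hai, hcj⟩ := exists_complementary_arcs hk hxz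
  have haJ := hIJ a haI
  have hcJ := hIJ c hcI
  have hcardA : Fintype.card (Option A) = d + 1 := by simpa using hA
  rw [← hcardA]
  refine connectsSet_of_connected (fun w : Option A => w.elim
    (level _ i ⊤ ⊔ column G z J ⊔ column G x (subgraphOfAdj _ hai) ⊔
      column G y (subgraphOfAdj _ hai) ⊔ column G z (subgraphOfAdj _ hcj))
    fun w => column G w.1 I ⊔ level _ a (P w ⊔ Y w) ⊔ level _ c (R w)) ?_ ?_ ?_ ?_
  · rintro (_ | ⟨w, hw⟩)
    · refine ((((((subgraph_top_connected hG.connected).level i).sup_of_mem (hJ.column z) (z, i)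
        ?_ ?_).sup_of_mem ((Subgraph.subgraphOfAdj_connected hai).column x) (x, i) ?_ ?_).sup_of_mem
        ((Subgraph.subgraphOfAdj_connected hai).column y) (y, i) ?_ ?_).sup_of_mem
        ((Subgraph.subgraphOfAdj_connected hcj).column z) (z, j) ?_ ?_)
      all_goals simp [hi, hj]
    · refine (((hI.column w).sup_of_mem (((hP w hw).1.sup_of_mem (hY w hw) w ?_ ?_).level a) (w, a)
        ?_ ?_).sup_of_mem ((hR w hw).1.level c) (w, c) ?_ ?_)
      all_goals simp [hP w hw, hR w hw, hYv w hw, haI, hcI]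
  · rintro (_ | ⟨w, hw⟩) v hv
    · rcases hv with rfl | rfl | rfl
      all_goals simp
    · rcases hv with rfl | rfl | rfl
      all_goals simp [hP w hw, hR w hw, hYv w hw]
  · have hnone : ∀ w (hw : w ∈ A), ∀ v ∈ (column G w I ⊔ level _ a (P w ⊔ Y w) ⊔
        level _ c (R w)).verts, v ∈ (level _ i ⊤ ⊔ column G z J ⊔ column G x (subgraphOfAdj _ hai) ⊔
      column G y (subgraphOfAdj _ hai) ⊔ column G z (subgraphOfAdj _ hcj)).verts →
        v ∈ ({(x, a), (y, a), (z, c)} : Set (V × ZMod k)) := by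
      rintro w hw ⟨v, b⟩ hv hv'
      simp only [Subgraph.verts_sup, Set.mem_union, mem_column_verts, mem_level_verts,
        Subgraph.verts_top, Set.mem_univ, and_true, subgraphOfAdj_verts, Set.mem_insert_iff,
        Set.mem_singleton_iff, hYv w hw, Prod.ext_iff] at hv hv' ⊢
      have := hIJ b
      grind
    rintro (_ | ⟨w, hw⟩) (_ | ⟨w', hw'⟩) hne v hv hv'
    · exact absurd rfl hne
    · exact hnone _ hw' v hv' hv
    · exact hnone _ hw v hv hv'
    · obtain ⟨v, b⟩ := v
      replace hne : w ≠ w' := fun h => hne (by simp [h])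
      have h1 := hP w hw
      have h2 := hR w hw
      have h3 := hP w' hw'
      have h4 := hR w' hw'
      have h5 := hPd w hw w' hw' hne
      have h6 := hRd w hw w' hw' hne
      simp only [Option.elim, Subgraph.verts_sup, Set.mem_union, mem_column_verts,
        mem_level_verts, hYv w hw, hYv w' hw', Set.mem_insert_iff,
        Set.mem_singleton_iff, Prod.ext_iff] at hv hv' ⊢
      grind
  · have hnone : ∀ w (hw : w ∈ A) u v, (column G w I ⊔ level _ a (P w ⊔ Y w) ⊔
        level _ c (R w)).Adj u v → ¬ (level _ i ⊤ ⊔ column G z J ⊔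
        column G x (subgraphOfAdj _ hai) ⊔ column G y (subgraphOfAdj _ hai) ⊔
        column G z (subgraphOfAdj _ hcj)).Adj u v := by
      rintro w hw ⟨u, b⟩ ⟨v, b'⟩ h h'
      simp only [Subgraph.sup_adj, column_adj, level_adj, Subgraph.top_adj,
        subgraphOfAdj_adj, Sym2.eq_iff] at h h'
      have h1 : I.Adj b b' → b ∈ I.verts ∧ b' ∈ I.verts := fun h => ⟨h.fst_mem, h.snd_mem⟩
      have h2 : J.Adj b b' → b ∈ J.verts ∧ b' ∈ J.verts := fun h => ⟨h.fst_mem, h.snd_mem⟩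
      have := hIJ b
      have := hIJ b'
      grind
    rintro (_ | ⟨w, hw⟩) (_ | ⟨w', hw'⟩) hne u v h h'
    · exact absurd rfl hne
    · exact hnone _ hw' u v h' h
    · exact hnone _ hw u v h h'
    · obtain ⟨u, b⟩ := u
      obtain ⟨v, b'⟩ := v
      replace hne : w ≠ w' := fun h => hne (by simp [h])
      simp only [Option.elim, Subgraph.sup_adj, column_adj, level_adj] at h h'
      have hmem : ∀ K : G.Subgraph, K.Adj u v → u ∈ K.verts ∧ v ∈ K.verts ∧ u ≠ v :=
        fun K h => ⟨h.fst_mem, h.snd_mem, h.ne⟩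
      have hirr : I.Adj b b' → b ≠ b' := fun h => h.ne
      have h1 := hP w hw
      have h3 := hP w' hw'
      have h5 := hPd w hw w' hw' hne
      have h6 := hRd w hw w' hw' hne
      have h7 := hYv w hw
      have h8 := hYv w' hw'
      have h9 := hmem (P w)
      have h10 := hmem (P w')
      have h11 := hmem (Y w)
      have h12 := hmem (Y w')
      have h13 := hmem (R w)
      have h14 := hmem (R w')
      grind

lemma RegularConnected.connectsSet_boxProd (hG : G.RegularConnected d) (hk : 3 ≤ k)
    (x y z : V × ZMod k) (hxz : x ≠ z) (hyz : y ≠ z) (hxy : x.2 ≠ y.2) :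
    ConnectsSet (G □ zmodCycle k) {x, y, z} (d + 1) := by
  by_cases h1 : x.2 = z.2
  · rw [Set.pair_comm]
    exact hG.connectsSet_of_two_levels hk x z y hxz h1 hxy
  by_cases h2 : y.2 = z.2
  · rw [Set.insert_comm, Set.pair_comm]
    exact hG.connectsSet_of_two_levels hk y z x hyz h2 hxy.symm
  exact hG.connectsSet_of_three_levels hk x y z hxy h1 h2

end Product

variable {S : Set V} {r d : ℕ}

lemma exists_adj_of_isTree {T : G.Subgraph} (hT : T.coe.IsTree) {x y : V} (hx : x ∈ T.verts)
    (hy : y ∈ T.verts) (hxy : x ≠ y) : ∃ v, T.Adj x v := by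
  obtain ⟨p⟩ := hT.connected.preconnected ⟨x, hx⟩ ⟨y, hy⟩
  cases p with
  | nil => exact absurd rfl hxy
  | @cons _ v _ h _ => exact ⟨v, h⟩

/-- The neighbors of `x` chosen in edge-disjoint trees through `x` and a further vertex. -/
lemma exists_injective_neighbor {T : Fin r → G.Subgraph} (hT : ∀ a, (T a).coe.IsTree)
    (hS : ∀ a, S ⊆ (T a).verts) (he : ∀ a b, a ≠ b → Disjoint (T a).edgeSet (T b).edgeSet)
    {x y : V} (hx : x ∈ S) (hy : y ∈ S) (hxy : x ≠ y) :
    ∃ f : Fin r → V, f.Injective ∧ (∀ a, (T a).Adj x (f a)) ∧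
      ∀ a b v, (T a).Adj x v → (T b).Adj x v → a = b := by
  choose f hf using fun a => exists_adj_of_isTree (hT a) (hS a hx) (hS a hy) hxy
  have huniq : ∀ a b v, (T a).Adj x v → (T b).Adj x v → a = b := by
    intro a b v ha hb
    by_contra hab
    exact Set.disjoint_left.1 (he a b hab) (show s(x, v) ∈ (T a).edgeSet from ha) hb
  exact ⟨f, fun a b hab => huniq a b (f a) (hf a) (by rw [hab]; exact hf b), hf, huniq⟩

lemma _root_.ConnectsSet.le_card (h : ConnectsSet G S r) {x y : V} (hx : x ∈ S) (hy : y ∈ S)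
    (hxy : x ≠ y) {N : Finset V} (hN : ∀ v, v ∈ N ↔ G.Adj x v) : r ≤ N.card := by
  obtain ⟨T, hT, hS, -, he⟩ := h
  obtain ⟨f, hinj, hf, -⟩ := exists_injective_neighbor hT hS he hx hy hxy
  simpa using Finset.card_le_card_of_injOn f (s := Finset.univ) (t := N)
    (fun a _ => (hN _).2 (hf a).adj_sub) hinj.injOn

/-- Two adjacent vertices of degree `d` in a set of three vertices exclude `d` disjoint trees. -/
lemma _root_.ConnectsSet.lt_card_of_adj (h : ConnectsSet G S r) {x y z : V} (hx : x ∈ S)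
    (hy : y ∈ S) (hz : z ∈ S) (hzx : z ≠ x) (hzy : z ≠ y) (hadj : G.Adj x y)
    {N M : Finset V} (hN : ∀ v, v ∈ N ↔ G.Adj x v) (hM : ∀ v, v ∈ M ↔ G.Adj y v)
    (hNd : N.card = d) (hMd : M.card = d) : r < d := by
  classical
  refine lt_of_le_of_ne (hNd ▸ h.le_card hx hy hadj.ne hN) ?_
  rintro rfl
  obtain ⟨T, hT, hS, -, he⟩ := h
  have honly : ∀ {x y : V} {N : Finset V}, x ∈ S → y ∈ S → G.Adj x y → (∀ v, v ∈ N ↔ G.Adj x v) →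
      N.card = r → ∃ a, (T a).Adj x y ∧ ∀ v, (T a).Adj x v → v = y := by
    intro x y N hx hy hadj hN hNr
    obtain ⟨f, hinj, hf, huniq⟩ := exists_injective_neighbor hT hS he hx hy hadj.ne
    have himg : Finset.univ.image f = N := by
      apply Finset.eq_of_subset_of_card_le
      · intro v hv
        obtain ⟨a, -, rfl⟩ := Finset.mem_image.1 hv
        exact (hN _).2 (hf a).adj_sub
      · rw [Finset.card_image_of_injective _ hinj, hNr]
        simp
    have hsurj : ∀ v, G.Adj x v → ∃ a, f a = v := by
      intro v hv
      rw [← hN, ← himg] at hv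
      simpa using hv
    obtain ⟨a, rfl⟩ := hsurj y hadj
    refine ⟨a, hf a, fun v hv => ?_⟩
    obtain ⟨b, rfl⟩ := hsurj v hv.adj_sub
    rw [huniq a b _ hv (hf b)]
  obtain ⟨a, ha, hax⟩ := honly hx hy hadj hN hNd
  obtain ⟨b, hb, hby⟩ := honly hy hx hadj.symm hM hMd
  obtain rfl : a = b := by
    by_contra hab
    exact Set.disjoint_left.1 (he a b hab) (show s(x, y) ∈ (T a).edgeSet from ha) hb.symm
  obtain ⟨p⟩ := (hT a).connected.preconnected ⟨x, hS a hx⟩ ⟨z, hS a hz⟩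
  have hclosed : ∀ {u v : (T a).verts}, (T a).coe.Walk u v → (u : V) = x ∨ (u : V) = y →
      (v : V) = x ∨ (v : V) = y := by
    intro u v p
    induction p with
    | nil => exact id
    | @cons u v w h p ih =>
      replace h : (T a).Adj u v := h
      rintro (hu | hu)
      · exact ih (Or.inr (hax _ (hu ▸ h)))
      · exact ih (Or.inl (hby _ (hu ▸ h)))
  rcases hclosed p (Or.inl rfl) with h | h
  exacts [hzx h, hzy h]

lemma karyCube_adj {k n : ℕ} (hk : 3 ≤ k) {u v : Fin n → ZMod k} :
    (karyCube k n).Adj u v ↔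
      ∃ j, (zmodCycle k).Adj (u j) (v j) ∧ ∀ i, i ≠ j → u i = v i := by
  simp only [zmodCycle_adj hk, karyCube, fromRel_adj]
  constructor
  · rintro ⟨-, ⟨j, h, h'⟩ | ⟨j, h, h'⟩⟩
    · exact ⟨j, Or.inl h, h'⟩
    · exact ⟨j, Or.inr h, fun i hi => (h' i hi).symm⟩
  · rintro ⟨j, h, h'⟩
    refine ⟨?_, ?_⟩
    · rintro rfl
      exact ((zmodCycle_adj hk).2 h).ne rfl
    · rcases h with h | h
      · exact Or.inl ⟨j, h, h'⟩
      · exact Or.inr ⟨j, h, fun i hi => (h' i hi).symm⟩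

/-- Splitting off one coordinate of the `k`-ary cube. -/
def karyCubeIso {k n : ℕ} (hk : 3 ≤ k) (i : Fin (n + 1)) :
    (karyCube k n).boxProd (zmodCycle k) ≃g karyCube k (n + 1) where
  toEquiv := (Equiv.prodComm _ _).trans (Fin.insertNthEquiv (fun _ => ZMod k) i)
  map_rel_iff' := by
    rintro ⟨u, a⟩ ⟨v, b⟩
    simp only [Equiv.trans_apply, Equiv.prodComm_apply, Prod.swap_prod_mk, Fin.insertNthEquiv,
      Equiv.coe_fn_mk, boxProd_adj, karyCube_adj hk]
    constructor
    · rintro ⟨j, h, h'⟩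
      rcases Fin.eq_self_or_eq_succAbove i j with rfl | ⟨j, rfl⟩
      · refine Or.inr ⟨by simpa using h, funext fun l => ?_⟩
        simpa using h' (j.succAbove l) (Fin.succAbove_ne _ _)
      · refine Or.inl ⟨⟨j, by simpa using h, fun l hl => ?_⟩, ?_⟩
        · simpa using h' (i.succAbove l) (by simpa using hl)
        · simpa using h' i (Fin.ne_succAbove _ _)
    · rintro (⟨⟨j, h, h'⟩, rfl⟩ | ⟨h, rfl⟩)
      · refine ⟨i.succAbove j, by simpa using h, fun l hl => ?_⟩
        rcases Fin.eq_self_or_eq_succAbove i l with rfl | ⟨l, rfl⟩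
        · simp
        · simpa using h' l (by simpa using hl)
      · refine ⟨i, by simpa using h, fun l hl => ?_⟩
        rcases Fin.eq_self_or_eq_succAbove i l with rfl | ⟨l, rfl⟩
        · exact absurd rfl hl
        · simp

lemma regularConnected_karyCube {k : ℕ} [NeZero k] (hk : 3 ≤ k) (n : ℕ) :
    (karyCube k n).RegularConnected (2 * n) := by
  induction n with
  | zero =>
    exact
      { reachOff := by simp
        connected := ⟨fun u v => by rw [Subsingleton.elim u v]⟩
        exists_neighbors := fun y => ⟨∅, by simp, fun v => by simp [Subsingleton.elim v y]⟩
        lt_card := by simp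
        even := by simp }
  | succ n ih => exact (ih.boxProd hk).iso (karyCubeIso hk 0)

lemma connectsSet_karyCube {k : ℕ} (hk : 3 ≤ k) (n : ℕ) {S : Set (Fin (n + 1) → ZMod k)}
    (hS : S.ncard = 3) : ConnectsSet (karyCube k (n + 1)) S (2 * n + 1) := by
  have : NeZero k := ⟨by omega⟩
  obtain ⟨x, y, z, hxy, hxz, hyz, rfl⟩ := Set.ncard_eq_three.1 hS
  obtain ⟨i, hi⟩ := Function.ne_iff.1 hxy
  let e := karyCubeIso (n := n) hk i
  have := ((regularConnected_karyCube hk n).connectsSet_boxProd hk (e.symm x) (e.symm y) (e.symm z)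
    (e.symm.injective.ne hxz) (e.symm.injective.ne hyz) hi).iso e
  simpa [Set.image_insert_eq] using this

end SimpleGraph

open SimpleGraph in
/-- `κ₃(Q_n^k) = 2n - 1` for all `k ≥ 3` and `n ≥ 1`. -/
theorem stmt_11 (k n : ℕ) (hk : 3 ≤ k) (hn : 1 ≤ n) :
    kappa3 (karyCube k n) = 2 * n - 1 := by
  have : NeZero k := ⟨by omega⟩
  obtain ⟨m, rfl⟩ : ∃ m, n = m + 1 := ⟨n - 1, by omega⟩
  have hreg := regularConnected_karyCube hk (m + 1)
  have hlower : ∀ S : Set (Fin (m + 1) → ZMod k), S.ncard = 3 →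
      2 * m + 1 ≤ treeConn (karyCube k (m + 1)) S := by
    intro S hS
    refine le_csSup ?_ (connectsSet_karyCube hk m hS)
    obtain ⟨x, y, z, hxy, -, -, rfl⟩ := Set.ncard_eq_three.1 hS
    obtain ⟨N, -, hN⟩ := hreg.exists_neighbors x
    exact ⟨N.card, fun r hr => hr.le_card (by simp) (by simp) hxy hN⟩
  obtain ⟨S, hS, hupper⟩ : ∃ S : Set (Fin (m + 1) → ZMod k), S.ncard = 3 ∧
      treeConn (karyCube k (m + 1)) S ≤ 2 * m + 1 := by
    let x : Fin (m + 1) → ZMod k := 0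
    obtain ⟨N, hNc, hN⟩ := hreg.exists_neighbors x
    obtain ⟨y, hy, z, hz, hyz⟩ := Finset.one_lt_card.1 (show 1 < N.card by omega)
    obtain ⟨M, hMc, hM⟩ := hreg.exists_neighbors y
    have hxy := (hN y).1 hy
    have hxz := (hN z).1 hz
    refine ⟨{x, y, z}, Set.ncard_eq_three.2 ⟨x, y, z, hxy.ne, hxz.ne, hyz, rfl⟩,
      csSup_le' fun r hr => ?_⟩
    have := hr.lt_card_of_adj (by simp) (by simp) (by simp) hxz.ne' hyz.symm hxy hN hM hNc hMc
    omega
  have h1 : kappa3 (karyCube k (m + 1)) ≤ 2 * m + 1 := by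
    refine le_trans (Nat.sInf_le ?_) hupper
    exact ⟨S, hS, rfl⟩
  have h2 : 2 * m + 1 ≤ kappa3 (karyCube k (m + 1)) := by
    refine le_csInf ⟨_, S, hS, rfl⟩ ?_
    rintro _ ⟨S, hS, rfl⟩
    exact hlower S hS
  omega
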